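/- arXiv:2401.17472 — 2 statements merged into one kernel-verified Lean document; each statement's English description precedes it below -/
import Mathlib

section
/- Let N ∈ ℕ, h > 0, T = N·h, k ∈ ℝ, L_x ≥ 0 and L_q > 0. Let (q_i)_{0≤i≤N−1}, (x_i)_{0≤i≤N} and (p_i)_{0≤i≤N} be nonnegative reals such that (1/2)·q_i·h ≤ (L_x/(2·L_q))·x_i·h + p_{i+1} − (1 − (2k + 2L_q)·h)·p_i for every 0 ≤ i ≤ N−1. Then Σ_{i=0}^{N−1} q_i·h ≤ (L_x·T/L_q)·max_{0≤n≤N} x_n + (max(4·(k + L_q)·T, 0) + 2)·max_{0≤n≤N} p_n. -/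
/-- **Telescoping-sum estimate (4.44).** If the nonnegative reals `(q_i)`, `(x_i)`, `(p_i)`
satisfy `(1/2) q_i h ≤ (L_x/(2 L_q)) x_i h + p_{i+1} - (1 - (2k + 2 L_q) h) p_i` for all
`0 ≤ i ≤ N-1`, then
`∑_{i=0}^{N-1} q_i h ≤ (L_x T / L_q) max_{0≤n≤N} x_n + (max(4 (k + L_q) T, 0) + 2) max_{0≤n≤N} p_n`. -/
theorem stmt_11 (N : ℕ) (h T k Lx Lq : ℝ) (hh : 0 < h) (hT : T = N * h)
    (hLx : 0 ≤ Lx) (hLq : 0 < Lq)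
    (q x p : ℕ → ℝ)
    (hq : ∀ i, i < N → 0 ≤ q i) (hx : ∀ n, n ≤ N → 0 ≤ x n) (hp : ∀ n, n ≤ N → 0 ≤ p n)
    (hrec : ∀ i, i < N →
      (1 / 2) * q i * h ≤ (Lx / (2 * Lq)) * x i * h + p (i + 1) - (1 - (2 * k + 2 * Lq) * h) * p i) :
    ∑ i ∈ Finset.range N, q i * h ≤
      (Lx * T / Lq) *
          ((Finset.range (N + 1)).sup' (Finset.nonempty_range_iff.mpr (Nat.succ_ne_zero N)) x) +
        (max (4 * (k + Lq) * T) 0 + 2) *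
          ((Finset.range (N + 1)).sup' (Finset.nonempty_range_iff.mpr (Nat.succ_ne_zero N)) p) := by
  set X := (Finset.range (N + 1)).sup' (Finset.nonempty_range_iff.mpr (Nat.succ_ne_zero N)) x
  set P := (Finset.range (N + 1)).sup' (Finset.nonempty_range_iff.mpr (Nat.succ_ne_zero N)) p
  have hxX : ∀ n, n ≤ N → x n ≤ X := fun n hn =>
    Finset.le_sup' x (Finset.mem_range_succ_iff.mpr hn)
  have hpP : ∀ n, n ≤ N → p n ≤ P := fun n hn =>
    Finset.le_sup' p (Finset.mem_range_succ_iff.mpr hn)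
  have hstep : ∀ i ∈ Finset.range N,
      q i * h ≤ (Lx / Lq * X * h + max (4 * (k + Lq)) 0 * P * h) + 2 * (p (i + 1) - p i) := by
    intro i hi
    have hiN := Finset.mem_range.mp hi
    have hxi : Lx / Lq * x i * h ≤ Lx / Lq * X * h := by
      gcongr
      exact hxX i hiN.le
    have hpi : 4 * (k + Lq) * p i * h ≤ max (4 * (k + Lq)) 0 * P * h := by
      have hi0 := hp i hiN.le
      gcongr
      · exact le_max_left _ _
      · exact hpP i hiN.le
    have hhalf : Lx / (2 * Lq) = Lx / Lq / 2 := by field_simp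
    have hr := hrec i hiN
    rw [hhalf] at hr
    linarith
  have hmax : max (4 * (k + Lq) * T) 0 = max (4 * (k + Lq)) 0 * T := by
    rw [max_mul_of_nonneg _ _ (by rw [hT]; positivity), zero_mul]
  calc ∑ i ∈ Finset.range N, q i * h
      ≤ ∑ i ∈ Finset.range N,
          ((Lx / Lq * X * h + max (4 * (k + Lq)) 0 * P * h) + 2 * (p (i + 1) - p i)) :=
        Finset.sum_le_sum hstep
    _ = Lx * T / Lq * X + max (4 * (k + Lq) * T) 0 * P + 2 * (p N - p 0) := by
        rw [Finset.sum_add_distrib, ← Finset.mul_sum, Finset.sum_range_sub, Finset.sum_const,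
          Finset.card_range, nsmul_eq_mul, hmax, hT]
        ring
    _ ≤ Lx * T / Lq * X + (max (4 * (k + Lq) * T) 0 + 2) * P := by
        linarith [hp 0 N.zero_le, hpP N le_rfl]
end

section
/- (Riccati verification for the LQ HJB equation.) Fix T > 0 and let Γ : [0,T] → ℝ^{d×d}, γ : [0,T] → ℝ^d and κ : [0,T] → ℝ be differentiable with Γ(t) symmetric for all t, Γ(T) = G, γ(T) = 0, κ(T) = 0, and suppose R̂(t) := R_u + Σ_{j=1}^m D_jᵀΓ(t)D_j is symmetric positive definite for every t ∈ [0,T]. Define Ŝ(t) := BᵀΓ(t) + R_{xu} + Σ_{j=1}^m D_jᵀΓ(t)C_j, Ψ(t) := R̂(t)⁻¹Ŝ(t) and ψ(t) := R̂(t)⁻¹·(Bᵀγ(t) + Σ_{j=1}^m D_jᵀΓ(t)Σ_j), and assume that for all t ∈ [0,T]: Γ'(t) + Γ(t)A + AᵀΓ(t) + Σ_{j=1}^m C_jᵀΓ(t)C_j + R_x − Ŝ(t)ᵀR̂(t)⁻¹Ŝ(t) = 0, γ'(t) + Aᵀγ(t) + Σ_{j=1}^m C_jᵀΓ(t)Σ_j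 − Ψ(t)ᵀR̂(t)ψ(t) + Γ(t)β = 0, and κ'(t) − ½ψ(t)ᵀR̂(t)ψ(t) + βᵀγ(t) + ½Σ_{j=1}^m Σ_jᵀΓ(t)Σ_j = 0. Then V(t,x) := ½xᵀΓ(t)x + xᵀγ(t) + κ(t) satisfies V(T,x) = ½xᵀGx for all x ∈ ℝ^d and solves the HJB equation: for all (t,x) ∈ [0,T]×ℝ^d, ∂_tV(t,x) = sup_{u ∈ ℝ^ℓ} 𝒢(x,u;Γ(t),γ(t)), and the supremum is attained at u*(t,x) = −Ψ(t)x − ψ(t). -/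
open Matrix

noncomputable section

/-- Euclidean inner product on `ℝ^n`. -/
def dotp {n : ℕ} (x y : Fin n → ℝ) : ℝ := ∑ i, x i * y i

/-- The LQ generalized Hamiltonian
`𝒢(x,u;Γ,γ) = -½uᵀR_u u - uᵀR_{xu} x - ½xᵀR_x x - (Ax+Bu+β)ᵀ(Γx+γ)
  - ½∑_j (C_j x + D_j u + Σ_j)ᵀ Γ (C_j x + D_j u + Σ_j)`. -/
def Gcal {d l m : ℕ} (A : Matrix (Fin d) (Fin d) ℝ) (B : Matrix (Fin d) (Fin l) ℝ)
    (β : Fin d → ℝ) (C : Fin m → Matrix (Fin d) (Fin d) ℝ)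
    (D : Fin m → Matrix (Fin d) (Fin l) ℝ) (Sg : Fin m → Fin d → ℝ)
    (Rx : Matrix (Fin d) (Fin d) ℝ) (Rxu : Matrix (Fin l) (Fin d) ℝ)
    (Ru : Matrix (Fin l) (Fin l) ℝ)
    (Γ : Matrix (Fin d) (Fin d) ℝ) (γ : Fin d → ℝ)
    (x : Fin d → ℝ) (u : Fin l → ℝ) : ℝ :=
  -(1 / 2) * dotp u (Ru.mulVec u) - dotp u (Rxu.mulVec x) - (1 / 2) * dotp x (Rx.mulVec x) -
    dotp (A.mulVec x + B.mulVec u + β) (Γ.mulVec x + γ) -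
    (1 / 2) * ∑ j, dotp ((C j).mulVec x + (D j).mulVec u + Sg j)
      (Γ.mulVec ((C j).mulVec x + (D j).mulVec u + Sg j))

/-- Moving a matrix across the dot product. -/
lemma mulVec_dotProduct_transpose {n k : ℕ} (M : Matrix (Fin n) (Fin k) ℝ)
    (x : Fin k → ℝ) (y : Fin n → ℝ) : (M *ᵥ x) ⬝ᵥ y = x ⬝ᵥ (Mᵀ *ᵥ y) := by
  rw [dotProduct_comm, dotProduct_mulVec, dotProduct_comm, mulVec_transpose]

/-- The bilinear form of a symmetric matrix is symmetric. -/
lemma dotProduct_mulVec_comm_of_isSymm {n : ℕ} {M : Matrix (Fin n) (Fin n) ℝ} (hM : M.IsSymm)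
    (x y : Fin n → ℝ) : x ⬝ᵥ (M *ᵥ y) = y ⬝ᵥ (M *ᵥ x) := by
  rw [dotProduct_comm, mulVec_dotProduct_transpose, hM.eq]

/-- The quadratic form of a symmetric matrix evaluated at a sum of three vectors. -/
lemma quadratic_form_add_three {n : ℕ} {M : Matrix (Fin n) (Fin n) ℝ} (hM : M.IsSymm)
    (a b c : Fin n → ℝ) :
    (a + b + c) ⬝ᵥ (M *ᵥ (a + b + c)) =
      a ⬝ᵥ (M *ᵥ a) + b ⬝ᵥ (M *ᵥ b) + c ⬝ᵥ (M *ᵥ c) +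
        2 * (b ⬝ᵥ (M *ᵥ a)) + 2 * (b ⬝ᵥ (M *ᵥ c)) + 2 * (a ⬝ᵥ (M *ᵥ c)) := by
  simp only [mulVec_add, dotProduct_add, add_dotProduct]
  rw [dotProduct_mulVec_comm_of_isSymm hM a b, dotProduct_mulVec_comm_of_isSymm hM c b,
    dotProduct_mulVec_comm_of_isSymm hM c a]
  ring

/-- Completing the square for the quadratic form of a symmetric matrix. -/
lemma quadratic_form_add {n : ℕ} {M : Matrix (Fin n) (Fin n) ℝ} (hM : M.IsSymm)
    (a b : Fin n → ℝ) :
    (a + b) ⬝ᵥ (M *ᵥ (a + b)) =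
      a ⬝ᵥ (M *ᵥ a) + 2 * (a ⬝ᵥ (M *ᵥ b)) + b ⬝ᵥ (M *ᵥ b) := by
  simp only [mulVec_add, dotProduct_add, add_dotProduct]
  rw [dotProduct_mulVec_comm_of_isSymm hM b a]
  ring

/-- The Hamiltonian as a quadratic polynomial in the control and the state. -/
lemma Gcal_eq {d l m : ℕ} (A : Matrix (Fin d) (Fin d) ℝ) (B : Matrix (Fin d) (Fin l) ℝ)
    (β : Fin d → ℝ) (C : Fin m → Matrix (Fin d) (Fin d) ℝ)
    (D : Fin m → Matrix (Fin d) (Fin l) ℝ) (Sg : Fin m → Fin d → ℝ)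
    (Rx : Matrix (Fin d) (Fin d) ℝ) (Rxu : Matrix (Fin l) (Fin d) ℝ)
    (Ru : Matrix (Fin l) (Fin l) ℝ) {Γ : Matrix (Fin d) (Fin d) ℝ} (hΓ : Γ.IsSymm)
    (γ x : Fin d → ℝ) (u : Fin l → ℝ) :
    Gcal A B β C D Sg Rx Rxu Ru Γ γ x u =
      -(1 / 2) * (u ⬝ᵥ ((Ru + ∑ j, (D j)ᵀ * Γ * D j) *ᵥ u)) -
        u ⬝ᵥ ((Bᵀ * Γ + Rxu + ∑ j, (D j)ᵀ * Γ * C j) *ᵥ x +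
          (Bᵀ *ᵥ γ + ∑ j, (D j)ᵀ *ᵥ (Γ *ᵥ Sg j))) -
        (1 / 2) * (x ⬝ᵥ ((Γ * A + Aᵀ * Γ + (∑ j, (C j)ᵀ * Γ * C j) + Rx) *ᵥ x)) -
        x ⬝ᵥ (Aᵀ *ᵥ γ + (∑ j, (C j)ᵀ *ᵥ (Γ *ᵥ Sg j)) + Γ *ᵥ β) -
        (β ⬝ᵥ γ + (1 / 2) * ∑ j, Sg j ⬝ᵥ (Γ *ᵥ Sg j)) := by
  have hA : x ⬝ᵥ (Γ *ᵥ (A *ᵥ x)) = x ⬝ᵥ (Aᵀ *ᵥ (Γ *ᵥ x)) := by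
    rw [dotProduct_mulVec_comm_of_isSymm hΓ, mulVec_dotProduct_transpose]
  have hβ := dotProduct_mulVec_comm_of_isSymm hΓ β x
  change -(1 / 2) * (u ⬝ᵥ (Ru *ᵥ u)) - u ⬝ᵥ (Rxu *ᵥ x) - (1 / 2) * (x ⬝ᵥ (Rx *ᵥ x)) -
    (A *ᵥ x + B *ᵥ u + β) ⬝ᵥ (Γ *ᵥ x + γ) -
    (1 / 2) * ∑ j, (C j *ᵥ x + D j *ᵥ u + Sg j) ⬝ᵥ
      (Γ *ᵥ (C j *ᵥ x + D j *ᵥ u + Sg j)) = _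
  simp only [quadratic_form_add_three hΓ, mulVec_dotProduct_transpose, add_mulVec, sum_mulVec,
    ← mulVec_mulVec, dotProduct_add, add_dotProduct, dotProduct_sum, Finset.sum_add_distrib,
    ← Finset.mul_sum, hA, hβ]
  ring

/-- Time derivative of the quadratic ansatz for the value function. -/
lemma hasDerivAt_quadratic_ansatz {d : ℕ} {Γ : ℝ → Matrix (Fin d) (Fin d) ℝ}
    {γ : ℝ → Fin d → ℝ} {κ : ℝ → ℝ} {Γ' : Matrix (Fin d) (Fin d) ℝ} {γ' : Fin d → ℝ} {κ' t : ℝ}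
    (hΓ : ∀ i j, HasDerivAt (fun s => Γ s i j) (Γ' i j) t)
    (hγ : ∀ i, HasDerivAt (fun s => γ s i) (γ' i) t) (hκ : HasDerivAt κ κ' t)
    (x : Fin d → ℝ) :
    HasDerivAt (fun s => (1 / 2) * dotp x ((Γ s).mulVec x) + dotp x (γ s) + κ s)
      ((1 / 2) * (x ⬝ᵥ (Γ' *ᵥ x)) + x ⬝ᵥ γ' + κ') t := by
  have hrow (i : Fin d) : HasDerivAt (fun s => (Γ s *ᵥ x) i) ((Γ' *ᵥ x) i) t := by
    simp only [mulVec, dotProduct]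
    exact HasDerivAt.fun_sum fun j _ => (hΓ i j).mul_const (x j)
  have hquad : HasDerivAt (fun s => x ⬝ᵥ (Γ s *ᵥ x)) (x ⬝ᵥ (Γ' *ᵥ x)) t :=
    HasDerivAt.fun_sum fun i _ => (hrow i).const_mul (x i)
  have hlin : HasDerivAt (fun s => x ⬝ᵥ γ s) (x ⬝ᵥ γ') t :=
    HasDerivAt.fun_sum fun i _ => (hγ i).const_mul (x i)
  exact ((hquad.const_mul (1 / 2)).add hlin).add hκ

/-- **Riccati verification for the LQ HJB equation.** If `Γ, γ, κ` solve the Riccati ODE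
system with terminal conditions `Γ(T) = G`, `γ(T) = 0`, `κ(T) = 0`, and
`R̂(t) = R_u + ∑_j D_jᵀΓ(t)D_j` is symmetric positive definite on `[0,T]`, then
`V(t,x) = ½xᵀΓ(t)x + xᵀγ(t) + κ(t)` satisfies `V(T,x) = ½xᵀGx` and solves the HJB
equation `∂_t V(t,x) = sup_u 𝒢(x,u;Γ(t),γ(t))`, the supremum being attained at
`u*(t,x) = -Ψ(t)x - ψ(t)`. -/
theorem stmt_19 {d l m : ℕ} (T : ℝ) (hT : 0 < T)
    (A : Matrix (Fin d) (Fin d) ℝ) (B : Matrix (Fin d) (Fin l) ℝ)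
    (β : Fin d → ℝ) (C : Fin m → Matrix (Fin d) (Fin d) ℝ)
    (D : Fin m → Matrix (Fin d) (Fin l) ℝ) (Sg : Fin m → Fin d → ℝ)
    (Rx : Matrix (Fin d) (Fin d) ℝ) (Rxu : Matrix (Fin l) (Fin d) ℝ)
    (Ru : Matrix (Fin l) (Fin l) ℝ) (G : Matrix (Fin d) (Fin d) ℝ)
    (hRx : Rx.IsSymm) (hRu : Ru.IsSymm) (hG : G.IsSymm)
    (Γ Γ' : ℝ → Matrix (Fin d) (Fin d) ℝ) (γ γ' : ℝ → Fin d → ℝ) (κ κ' : ℝ → ℝ)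
    (hΓsymm : ∀ t, (Γ t).IsSymm)
    (hΓderiv : ∀ (t : ℝ) (i j : Fin d), HasDerivAt (fun s => Γ s i j) (Γ' t i j) t)
    (hγderiv : ∀ (t : ℝ) (i : Fin d), HasDerivAt (fun s => γ s i) (γ' t i) t)
    (hκderiv : ∀ t : ℝ, HasDerivAt κ (κ' t) t)
    (hΓT : Γ T = G) (hγT : γ T = 0) (hκT : κ T = 0)
    (Rhat : ℝ → Matrix (Fin l) (Fin l) ℝ)
    (hRhat : ∀ t, Rhat t = Ru + ∑ j, (D j)ᵀ * Γ t * D j)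
    (hRhatpd : ∀ t ∈ Set.Icc (0 : ℝ) T, (Rhat t).PosDef)
    (Shat : ℝ → Matrix (Fin l) (Fin d) ℝ)
    (hShat : ∀ t, Shat t = Bᵀ * Γ t + Rxu + ∑ j, (D j)ᵀ * Γ t * C j)
    (Ψ : ℝ → Matrix (Fin l) (Fin d) ℝ) (hΨ : ∀ t, Ψ t = (Rhat t)⁻¹ * Shat t)
    (ψv : ℝ → Fin l → ℝ)
    (hψv : ∀ t, ψv t =
      (Rhat t)⁻¹.mulVec (Bᵀ.mulVec (γ t) + ∑ j, (D j)ᵀ.mulVec ((Γ t).mulVec (Sg j))))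
    (hRiccatiΓ : ∀ t ∈ Set.Icc (0 : ℝ) T,
      Γ' t + Γ t * A + Aᵀ * Γ t + (∑ j, (C j)ᵀ * Γ t * C j) + Rx -
        (Shat t)ᵀ * (Rhat t)⁻¹ * Shat t = 0)
    (hRiccatiγ : ∀ t ∈ Set.Icc (0 : ℝ) T,
      γ' t + Aᵀ.mulVec (γ t) + (∑ j, (C j)ᵀ.mulVec ((Γ t).mulVec (Sg j))) -
        (Ψ t)ᵀ.mulVec ((Rhat t).mulVec (ψv t)) + (Γ t).mulVec β = 0)
    (hRiccatiκ : ∀ t ∈ Set.Icc (0 : ℝ) T,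
      κ' t - (1 / 2) * dotp (ψv t) ((Rhat t).mulVec (ψv t)) + dotp β (γ t) +
        (1 / 2) * ∑ j, dotp (Sg j) ((Γ t).mulVec (Sg j)) = 0) :
    (∀ x : Fin d → ℝ,
      (1 / 2) * dotp x ((Γ T).mulVec x) + dotp x (γ T) + κ T =
        (1 / 2) * dotp x (G.mulVec x)) ∧
    ∀ t ∈ Set.Icc (0 : ℝ) T, ∀ x : Fin d → ℝ,
      (∀ u : Fin l → ℝ,
        Gcal A B β C D Sg Rx Rxu Ru (Γ t) (γ t) x u ≤
          Gcal A B β C D Sg Rx Rxu Ru (Γ t) (γ t) x (-((Ψ t).mulVec x) - ψv t)) ∧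
      HasDerivAt (fun s => (1 / 2) * dotp x ((Γ s).mulVec x) + dotp x (γ s) + κ s)
        (Gcal A B β C D Sg Rx Rxu Ru (Γ t) (γ t) x (-((Ψ t).mulVec x) - ψv t)) t := by
  refine ⟨fun x => by simp [hΓT, hγT, hκT, dotp], fun t ht x => ?_⟩
  have hpd := hRhatpd t ht
  have hsymm : (Rhat t).IsSymm := by simpa [IsHermitian, IsSymm] using hpd.isHermitian
  have hcancel (v : Fin l → ℝ) : Rhat t *ᵥ ((Rhat t)⁻¹ *ᵥ v) = v := by
    rw [mulVec_mulVec, mul_nonsing_inv _ ((isUnit_iff_isUnit_det _).mp hpd.isUnit), one_mulVec]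
  set w := Ψ t *ᵥ x + ψv t with hw
  have hcontrol : -(Ψ t *ᵥ x) - ψv t = -w := by rw [hw]; abel
  have hRw : Rhat t *ᵥ w = Shat t *ᵥ x +
      (Bᵀ *ᵥ γ t + ∑ j, (D j)ᵀ *ᵥ (Γ t *ᵥ Sg j)) := by
    rw [hw, mulVec_add, hΨ, hψv, ← mulVec_mulVec, hcancel, hcancel]
  have hGcal (u : Fin l → ℝ) := Gcal_eq A B β C D Sg Rx Rxu Ru (hΓsymm t) (γ t) x u
  simp only [← hRhat, ← hShat, ← hRw] at hGcal
  rw [hcontrol]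
  refine ⟨fun u => ?_, ?_⟩
  · have hnonneg : 0 ≤ (u + w) ⬝ᵥ (Rhat t *ᵥ (u + w)) := by
      simpa using hpd.posSemidef.dotProduct_mulVec_nonneg (u + w)
    rw [quadratic_form_add hsymm] at hnonneg
    rw [hGcal, hGcal]
    simp only [mulVec_neg, dotProduct_neg, neg_dotProduct, neg_neg]
    linarith
  · convert hasDerivAt_quadratic_ansatz (hΓderiv t) (hγderiv t) (hκderiv t) x using 1
    have hwR : w ⬝ᵥ (Rhat t *ᵥ w) = x ⬝ᵥ (((Shat t)ᵀ * (Rhat t)⁻¹ * Shat t) *ᵥ x) +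
        2 * (x ⬝ᵥ ((Ψ t)ᵀ *ᵥ (Rhat t *ᵥ ψv t))) + ψv t ⬝ᵥ (Rhat t *ᵥ ψv t) := by
      have hquad : (Ψ t *ᵥ x) ⬝ᵥ (Rhat t *ᵥ (Ψ t *ᵥ x)) =
          x ⬝ᵥ (((Shat t)ᵀ * (Rhat t)⁻¹ * Shat t) *ᵥ x) := by
        rw [dotProduct_comm, hΨ]
        simp only [← mulVec_mulVec, hcancel, mulVec_dotProduct_transpose]
      rw [hw, quadratic_form_add hsymm, hquad, mulVec_dotProduct_transpose]
    have hΓx := congrArg (fun M => x ⬝ᵥ (M *ᵥ x)) (hRiccatiΓ t ht)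
    have hγx := congrArg (fun v => x ⬝ᵥ v) (hRiccatiγ t ht)
    have hκt : κ' t - (1 / 2) * (ψv t ⬝ᵥ (Rhat t *ᵥ ψv t)) + β ⬝ᵥ γ t +
        (1 / 2) * ∑ j, Sg j ⬝ᵥ (Γ t *ᵥ Sg j) = 0 := hRiccatiκ t ht
    rw [hGcal]
    simp only [mulVec_neg, dotProduct_neg, neg_dotProduct, neg_neg, add_mulVec, sub_mulVec,
      zero_mulVec, dotProduct_add, dotProduct_sub, dotProduct_zero] at hΓx hγx ⊢
    linarith
end
end
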